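/- arXiv:2306.03808 — 2 statements merged into one kernel-verified Lean document; each statement's English description precedes it below -/
import Mathlib

section
/- Let $\varphi$ be a continuous function on $\mathbb{T}^d$ dominated by $L-\alpha$. Then $\varphi$ is Lipschitz continuous with respect to the sub-Riemannian distance, with a Lipschitz constant $C_L$ depending only on $L$: there exists $C_L \ge 0$ such that $|\varphi(x)-\varphi(y)| \le C_L\, d_{SR}(x,y)$ for all $x,y \in \mathbb{T}^d$. -/
/- Aubry-Mather theory for sub-Riemannian control systems
   (P. Cannarsa, C. Mendico et al., arXiv:2306.03808).

   We model the torus `𝕋^d` as `ℝ^d` modulo `ℤ^d`: points are represented by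
   elements of `E d := EuclideanSpace ℝ (Fin d)`, functions on the torus are
   `ℤ^d`-periodic functions on `ℝ^d`, and equality of torus points is equality
   up to an integer translation (`torusEq`). -/

open MeasureTheory Filter Topology Set Metric Asymptotics RealInnerProductSpace

noncomputable section

namespace SubRiemannianAM

/-- Euclidean space `ℝ^n`. -/
abbrev E (n : ℕ) : Type := EuclideanSpace ℝ (Fin n)

variable {d m : ℕ}

/-- The vector of `ℝ^d` with integer coordinates `k`. -/
def intVec (k : Fin d → ℤ) : E d :=
  (EuclideanSpace.equiv (Fin d) ℝ).symm fun i => (k i : ℝ)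

/-- Two points of `ℝ^d` represent the same point of the torus `ℝ^d/ℤ^d`. -/
def torusEq (x y : E d) : Prop := ∃ k : Fin d → ℤ, y = x + intVec k

/-- A `ℤ^d`-periodic function on `ℝ^d`, i.e. a function on the torus `𝕋^d`. -/
def ZPeriodic {α : Type*} (f : E d → α) : Prop :=
  ∀ (x : E d) (k : Fin d → ℤ), f (x + intVec k) = f x

/-- Periodicity in the state variable for Lagrangians `L : 𝕋^d × ℝ^m → ℝ`. -/
def ZPeriodic2 {α : Type*} (L : E d → E m → α) : Prop :=
  ∀ (x : E d) (k : Fin d → ℤ) (u : E m), L (x + intVec k) u = L x u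

/-- A trajectory-control pair on `[a, b]` for the control-affine system
`γ' = F(γ) u`: `γ` is absolutely continuous (given by the integral equation),
`u` is square-integrable, and the state equation holds. -/
structure IsPair (F : E d → E m →L[ℝ] E d) (a b : ℝ) (γ : ℝ → E d) (u : ℝ → E m) : Prop where
  cont : ContinuousOn γ (Icc a b)
  u_sq_int : IntegrableOn (fun s => ‖u s‖ ^ 2) (Icc a b)
  rhs_int : IntegrableOn (fun s => F (γ s) (u s)) (Icc a b)
  ode : ∀ t ∈ Icc a b, γ t = γ a + ∫ s in a..t, F (γ s) (u s)

/-- The Lagrangian action `∫_a^b L(γ(s), u(s)) ds` of a trajectory-control pair. -/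
def cost (L : E d → E m → ℝ) (γ : ℝ → E d) (u : ℝ → E m) (a b : ℝ) : ℝ :=
  ∫ s in a..b, L (γ s) (u s)

/-- The fundamental solution / action `A_t(x,y)`: the infimal cost over
trajectory-control pairs joining `x` to `y` (as torus points) in time `t`. -/
def Action (F : E d → E m →L[ℝ] E d) (L : E d → E m → ℝ) (t : ℝ) (x y : E d) : ℝ :=
  sInf { c | ∃ γ u, IsPair F 0 t γ u ∧ γ 0 = x ∧ torusEq y (γ t) ∧ c = cost L γ u 0 t }

/-- The value function `V^T(x)` of the free-endpoint minimization problem. -/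
def Val (F : E d → E m →L[ℝ] E d) (L : E d → E m → ℝ) (T : ℝ) (x : E d) : ℝ :=
  sInf { c | ∃ γ u, IsPair F 0 T γ u ∧ γ 0 = x ∧ c = cost L γ u 0 T }

/-- The sub-Riemannian distance on the torus: infimal time needed to join `x`
to `y` by an admissible trajectory with control of norm at most `1`. -/
def dSR (F : E d → E m →L[ℝ] E d) (x y : E d) : ℝ :=
  sInf { T | 0 ≤ T ∧ ∃ γ u, IsPair F 0 T γ u ∧ γ 0 = x ∧ torusEq y (γ T) ∧
    (∀ᵐ s ∂(volume.restrict (Icc 0 T)), ‖u s‖ ≤ 1) }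

/-- Peierls' barrier `h(x,y) = liminf_{t → ∞} [A_t(x,y) - α t]`. -/
def PB (F : E d → E m →L[ℝ] E d) (L : E d → E m → ℝ) (α : ℝ) (x y : E d) : ℝ :=
  liminf (fun t => Action F L t x y - α * t) atTop

/-- The Hamiltonian `H(x,p) = sup_u { ⟨F*(x)p, u⟩ - L(x,u) }`. -/
def Ham (F : E d → E m →L[ℝ] E d) (L : E d → E m → ℝ) (x : E d) (p : E d) : ℝ :=
  sSup { v | ∃ u : E m, v = ⟪p, F x u⟫ - L x u }

/-- The Legendre transform `L*(x,q) = sup_u { ⟨q, u⟩ - L(x,u) }` in the control variable. -/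
def Lstar (L : E d → E m → ℝ) (x : E d) (q : E m) : ℝ :=
  sSup { v | ∃ u : E m, v = ⟪q, u⟫ - L x u }

/-- `φ` is dominated by `L - c` (`φ ≺ L - c`). -/
def Dominated (F : E d → E m →L[ℝ] E d) (L : E d → E m → ℝ) (c : ℝ) (φ : E d → ℝ) : Prop :=
  ∀ (a b : ℝ) (γ : ℝ → E d) (u : ℝ → E m), a < b → IsPair F a b γ u →
    φ (γ b) - φ (γ a) ≤ cost L γ u a b - c * (b - a)

/-- A trajectory-control pair `(γ, u)` is calibrated for `φ` on the set `I`
(for the critical constant `α`). -/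
def Calibrated (F : E d → E m →L[ℝ] E d) (L : E d → E m → ℝ) (α : ℝ) (φ : E d → ℝ)
    (γ : ℝ → E d) (u : ℝ → E m) (I : Set ℝ) : Prop :=
  (∀ a b : ℝ, a ∈ I → b ∈ I → a ≤ b → IsPair F a b γ u) ∧
  (∀ a b : ℝ, a ∈ I → b ∈ I → a ≤ b →
    φ (γ b) - φ (γ a) = cost L γ u a b - α * (b - a))

/-- The Lax-Oleinik semigroup `T_t v (x)`. -/
def LaxOp (F : E d → E m →L[ℝ] E d) (L : E d → E m → ℝ) (t : ℝ) (v : E d → ℝ) (x : E d) : ℝ :=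
  sInf { c | ∃ γ u, IsPair F 0 t γ u ∧ torusEq x (γ t) ∧ c = v (γ 0) + cost L γ u 0 t }

/-- `χ` is a fixed point of the Lax-Oleinik semigroup:
`χ(x) = min_y { χ(y) + A_t(y,x) } - α t` for all `t > 0`, the minimum being attained. -/
def LaxFixed (F : E d → E m →L[ℝ] E d) (L : E d → E m → ℝ) (α : ℝ) (χ : E d → ℝ) : Prop :=
  ∀ t : ℝ, 0 < t → ∀ x : E d,
    IsLeast { c | ∃ y : E d, c = χ y + Action F L t y x } (χ x + α * t)

/-- Viscosity subsolution of `c + H(x, Dv) = 0` on `U` (via `C¹` test functions). -/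
def VSubsolOn (F : E d → E m →L[ℝ] E d) (L : E d → E m → ℝ) (c : ℝ) (v : E d → ℝ)
    (U : Set (E d)) : Prop :=
  ∀ φ : E d → ℝ, ContDiff ℝ 1 φ → ∀ x ∈ U, IsLocalMax (fun y => v y - φ y) x →
    c + Ham F L x (gradient φ x) ≤ 0

/-- Viscosity supersolution of `c + H(x, Dv) = 0` on `U`. -/
def VSupersolOn (F : E d → E m →L[ℝ] E d) (L : E d → E m → ℝ) (c : ℝ) (v : E d → ℝ)
    (U : Set (E d)) : Prop :=
  ∀ φ : E d → ℝ, ContDiff ℝ 1 φ → ∀ x ∈ U, IsLocalMin (fun y => v y - φ y) x →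
    0 ≤ c + Ham F L x (gradient φ x)

/-- Viscosity solution of `c + H(x, Dv) = 0` on all of the torus. -/
def VSol (F : E d → E m →L[ℝ] E d) (L : E d → E m → ℝ) (c : ℝ) (v : E d → ℝ) : Prop :=
  VSubsolOn F L c v univ ∧ VSupersolOn F L c v univ

/-- The (Euclidean) superdifferential `D⁺φ(x)`. -/
def superdiff (φ : E d → ℝ) (x : E d) : Set (E d) :=
  { p | ∀ ε : ℝ, 0 < ε → ∀ᶠ y in 𝓝 x, φ y - φ x - ⟪p, y - x⟫ ≤ ε * ‖y - x‖ }

/-- The horizontal superdifferential `D⁺_F φ(x) = F*(x) D⁺φ(x)`. -/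
def superdiffF (F : E d → E m →L[ℝ] E d) (φ : E d → ℝ) (x : E d) : Set (E m) :=
  (ContinuousLinearMap.adjoint (F x)) '' superdiff φ x

/-- `ψ` is differentiable at `x` along the range of `F(x)` with horizontal
differential `q`: `ψ(x + F(x)v) - ψ(x) - ⟨q, v⟩ = o(|v|)` as `v → 0`. -/
def HorizDiffWith (F : E d → E m →L[ℝ] E d) (ψ : E d → ℝ) (x : E d) (q : E m) : Prop :=
  (fun v : E m => ψ (x + F x v) - ψ x - ⟪q, v⟫) =o[𝓝 0] fun v : E m => ‖v‖

/-- Horizontal differentiability of `ψ` at `x`. -/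
def HorizDiffAt (F : E d → E m →L[ℝ] E d) (ψ : E d → ℝ) (x : E d) : Prop :=
  ∃ q : E m, HorizDiffWith F ψ x q

/-- Global semiconcavity with linear modulus (constant `C`). -/
def SemiconcaveWith (C : ℝ) (φ : E d → ℝ) : Prop :=
  ∀ x y : E d, ∀ t ∈ Icc (0:ℝ) 1,
    t * φ x + (1 - t) * φ y - φ (t • x + (1 - t) • y) ≤ C * t * (1 - t) * ‖x - y‖ ^ 2

/-- Local semiconcavity (with linear modulus) of a function on `ℝ^d`. -/
def LocSemiconcave (φ : E d → ℝ) : Prop :=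
  ∀ x : E d, ∃ r > (0:ℝ), ∃ C : ℝ, ∀ y ∈ ball x r, ∀ z ∈ ball x r, ∀ t ∈ Icc (0:ℝ) 1,
    t * φ y + (1 - t) * φ z - φ (t • y + (1 - t) • z) ≤ C * t * (1 - t) * ‖y - z‖ ^ 2

/-- The one-sided horizontal directional derivative
`∂_F φ(x, θ) = lim_{h → 0⁺} (φ(x + h F(x)θ) - φ(x))/h` (as a `limsup`, which
coincides with the limit whenever the latter exists, e.g. for semiconcave `φ`). -/
def hdd (F : E d → E m →L[ℝ] E d) (φ : E d → ℝ) (x : E d) (θ : E m) : ℝ :=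
  limsup (fun h : ℝ => (φ (x + h • F x θ) - φ x) / h) (𝓝[>] 0)

/-- Probability measures on `𝕋^d × ℝ^m` with finite `σ`-moment in the control
variable (the class `𝒫^σ`). -/
def MemPσ (σ : ℝ) (μ : Measure (E d × E m)) : Prop :=
  IsProbabilityMeasure μ ∧ ∫⁻ z, ENNReal.ofReal (‖z.2‖ ^ σ) ∂μ < ⊤

/-- `F`-closed measures: `∫ ⟨F*(x)Dφ(x), u⟩ dμ = 0` for all `φ ∈ C¹(𝕋^d)`. -/
def FClosedM (F : E d → E m →L[ℝ] E d) (μ : Measure (E d × E m)) : Prop :=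
  ∀ φ : E d → ℝ, ContDiff ℝ 1 φ → ZPeriodic φ →
    ∫ z : E d × E m, ⟪gradient φ z.1, F z.1 z.2⟫ ∂μ = 0

/-- Strongly `F`-closed measures: `∫ ∂_F φ(x,u) dμ = 0` for every semiconcave
function `φ` on the torus. -/
def SFClosedM (F : E d → E m →L[ℝ] E d) (μ : Measure (E d × E m)) : Prop :=
  ∀ (φ : E d → ℝ) (C : ℝ), SemiconcaveWith C φ → ZPeriodic φ →
    ∫ z : E d × E m, hdd F φ z.1 z.2 ∂μ = 0

/-- The canonical projection of `ℝ^d` onto the fundamental domain `[0,1)^d` of the torus. -/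
def torusProj (x : E d) : E d :=
  (EuclideanSpace.equiv (Fin d) ℝ).symm fun i => Int.fract (x i)

/-- The occupation measure `μ^T` of a trajectory-control pair:
`∫ φ dμ^T = (1/T) ∫_0^T φ(γ(t), u(t)) dt` (states projected to the torus). -/
def occ (γ : ℝ → E d) (u : ℝ → E m) (T : ℝ) : Measure (E d × E m) :=
  (ENNReal.ofReal T)⁻¹ • Measure.map (fun s => (torusProj (γ s), u s)) (volume.restrict (Icc 0 T))

/-- Support of a measure on `𝕋^d × ℝ^m`. -/
def msupp (μ : Measure (E d × E m)) : Set (E d × E m) :=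
  { z | ∀ U : Set (E d × E m), IsOpen U → z ∈ U → 0 < μ U }

/-- Support of the first (state) marginal of a measure on `𝕋^d × ℝ^m`. -/
def msuppX (μ : Measure (E d × E m)) : Set (E d) :=
  { x | ∀ U : Set (E d), IsOpen U → x ∈ U → 0 < μ (U ×ˢ (univ : Set (E m))) }

/-- A Mather measure: a strongly `F`-closed measure in `𝒫^σ` whose Lagrangian
action equals the critical constant `α`. -/
def MatherMeas (F : E d → E m →L[ℝ] E d) (L : E d → E m → ℝ) (σ α : ℝ)
    (μ : Measure (E d × E m)) : Prop :=
  MemPσ σ μ ∧ SFClosedM F μ ∧ Integrable (fun z : E d × E m => L z.1 z.2) μ ∧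
    (∫ z : E d × E m, L z.1 z.2 ∂μ) = α

/-- The Mather set: closure of the union of the supports of all Mather measures. -/
def MatherSet (F : E d → E m →L[ℝ] E d) (L : E d → E m → ℝ) (σ α : ℝ) : Set (E d × E m) :=
  closure { z | ∃ μ : Measure (E d × E m), MatherMeas F L σ α μ ∧ z ∈ msupp μ }

/-- The projected Mather set. -/
def projMather (F : E d → E m →L[ℝ] E d) (L : E d → E m → ℝ) (σ α : ℝ) : Set (E d) :=
  Prod.fst '' MatherSet F L σ α

/-- Standing assumptions (F) and (L): `F` is `C^{1,1}`, `ℤ^d`-periodic and of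
full rank `m`; `L` is `C²`, convex in `u`, `ℤ^d`-periodic in `x`, with
superlinear growth `L(x,u) ≥ K₁|u|^σ - K₂`, `σ > 1`. -/
structure StdSetup (F : E d → E m →L[ℝ] E d) (L : E d → E m → ℝ) (σ K1 K2 : ℝ) : Prop where
  F_c1 : ContDiff ℝ 1 F
  F_lip : ∃ K : NNReal, LipschitzWith K (fderiv ℝ F)
  F_rank : ∀ x : E d, Function.Injective ⇑(F x)
  F_per : ZPeriodic F
  L_c2 : ContDiff ℝ 2 fun p : E d × E m => L p.1 p.2
  L_conv : ∀ x : E d, ConvexOn ℝ univ (L x)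
  L_per : ZPeriodic2 L
  sigma_gt : (1:ℝ) < σ
  K1_pos : (0:ℝ) < K1
  K2_pos : (0:ℝ) < K2
  L_coer : ∀ (x : E d) (u : E m), K1 * ‖u‖ ^ σ - K2 ≤ L x u

/-- Consequences of the Hörmander condition used throughout: controllability,
existence of sub-Riemannian geodesics, and continuity of the sub-Riemannian
distance. -/
structure SRSetup (F : E d → E m →L[ℝ] E d) : Prop where
  reach : ∀ x y : E d, ∃ T : ℝ, 0 ≤ T ∧ ∃ γ u, IsPair F 0 T γ u ∧ γ 0 = x ∧
    torusEq y (γ T) ∧ (∀ᵐ s ∂(volume.restrict (Icc 0 T)), ‖u s‖ ≤ 1)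
  geodesic : ∀ x y : E d, ∃ γ u, IsPair F 0 (dSR F x y) γ u ∧ γ 0 = x ∧
    torusEq y (γ (dSR F x y)) ∧
    (∀ᵐ s ∂(volume.restrict (Icc 0 (dSR F x y))), ‖u s‖ ≤ 1)
  dist_cont : Continuous fun p : E d × E d => dSR F p.1 p.2
/-- The time reversal of a trajectory-control pair on `[0, T]`. -/
lemma IsPair.reverse {F : E d → E m →L[ℝ] E d} {T : ℝ} {γ : ℝ → E d} {u : ℝ → E m}
    (hT : 0 ≤ T) (h : IsPair F 0 T γ u) :
    IsPair F 0 T (fun t => γ (T - t)) (fun t => -u (T - t)) := by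
  have integrable_reflect : ∀ {G : Type} [NormedAddCommGroup G] (f : ℝ → G),
      IntegrableOn f (Icc 0 T) → IntegrableOn (fun s => f (T - s)) (Icc 0 T) := by
    intro G _ f hf
    rw [integrableOn_Icc_iff_integrableOn_Ioc,
      ← intervalIntegrable_iff_integrableOn_Ioc_of_le hT] at hf ⊢
    simpa using (hf.comp_sub_left T).symm
  refine ⟨?_, ?_, ?_, ?_⟩
  · refine h.cont.comp (by fun_prop) fun t ht => ?_
    exact ⟨by linarith [ht.2], by linarith [ht.1]⟩
  · simpa using integrable_reflect _ h.u_sq_int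
  · simpa using (integrable_reflect _ h.rhs_int).neg
  · intro t ht
    have ht' : T - t ∈ Icc 0 T := ⟨by linarith [ht.2], by linarith [ht.1]⟩
    have hint : IntervalIntegrable (fun s => F (γ s) (u s)) volume 0 T := by
      rw [intervalIntegrable_iff_integrableOn_Ioc_of_le hT,
        ← integrableOn_Icc_iff_integrableOn_Ioc]
      exact h.rhs_int
    have hint' : IntervalIntegrable (fun s => F (γ s) (u s)) volume 0 (T - t) :=
      hint.mono_set (by
        rw [uIcc_of_le ht'.1, uIcc_of_le hT]
        exact Icc_subset_Icc_right ht'.2)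
    have hrefl : (∫ s in (0 : ℝ)..t, F (γ (T - s)) (u (T - s))) =
        ∫ s in (T - t)..T, F (γ s) (u s) := by
      simpa using intervalIntegral.integral_comp_sub_left
        (fun s => F (γ s) (u s)) T (a := 0) (b := t)
    simp only [map_neg, intervalIntegral.integral_neg, sub_zero]
    rw [hrefl, ← intervalIntegral.integral_interval_sub_left hint hint',
      h.ode _ ht', h.ode T ⟨hT, le_rfl⟩]
    abel

lemma cost_reverse (L : E d → E m → ℝ) (γ : ℝ → E d) (u : ℝ → E m) (T : ℝ) :
    cost L (fun t => γ (T - t)) (fun t => -u (T - t)) 0 T = cost L γ (fun t => -u t) 0 T := by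
  simpa [cost] using intervalIntegral.integral_comp_sub_left
    (fun s => L (γ s) (-u s)) T (a := 0) (b := T)

/-- A continuous periodic Lagrangian is bounded on controls of norm at most one. -/
lemma ZPeriodic2.exists_bound {L : E d → E m → ℝ} (hper : ZPeriodic2 L)
    (hcont : Continuous fun p : E d × E m => L p.1 p.2) :
    ∃ B : ℝ, 0 ≤ B ∧ ∀ (x : E d) (u : E m), ‖u‖ ≤ 1 → ‖L x u‖ ≤ B := by
  have hK : IsCompact (((EuclideanSpace.equiv (Fin d) ℝ).symm '' Icc 0 1) ×ˢ
      closedBall (0 : E m) 1) :=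
    (isCompact_Icc.image (EuclideanSpace.equiv (Fin d) ℝ).symm.continuous).prod
      (isCompact_closedBall 0 1)
  obtain ⟨B, hB⟩ := hK.exists_bound_of_continuousOn hcont.continuousOn
  refine ⟨max B 0, le_max_right _ _, fun x u hu => le_max_of_le_left ?_⟩
  have hproj : torusProj x = x + intVec fun i => -⌊x i⌋ := by
    ext i
    simp [torusProj, intVec, Int.fract, sub_eq_add_neg]
  rw [← hper x (fun i => -⌊x i⌋) u, ← hproj]
  refine hB (torusProj x, u) ⟨mem_image_of_mem _ ⟨fun i => ?_, fun i => ?_⟩, by simpa using hu⟩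
  · exact Int.fract_nonneg _
  · exact (Int.fract_lt_one _).le

lemma abs_cost_le {L : E d → E m → ℝ} {B T : ℝ}
    (hB : ∀ (x : E d) (u : E m), ‖u‖ ≤ 1 → ‖L x u‖ ≤ B) (hT : 0 ≤ T)
    (γ : ℝ → E d) {u : ℝ → E m} (hu : ∀ᵐ s ∂(volume.restrict (Icc 0 T)), ‖u s‖ ≤ 1) :
    |cost L γ u 0 T| ≤ B * T := by
  have hae : ∀ᵐ s, s ∈ uIoc 0 T → ‖L (γ s) (u s)‖ ≤ B := by
    filter_upwards [(ae_restrict_iff' measurableSet_Icc).1 hu] with s hs hmem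
    rw [uIoc_of_le hT] at hmem
    exact hB _ _ (hs (Ioc_subset_Icc_self hmem))
  simpa [cost, abs_of_nonneg hT] using intervalIntegral.norm_integral_le_of_norm_le_const_ae hae

/-- Any continuous function on the torus dominated by `L - α`
is Lipschitz continuous w.r.t. the sub-Riemannian distance, with a Lipschitz
constant depending only on the data. -/
theorem dominated_lipschitz {d m : ℕ}
    (F : E d → E m →L[ℝ] E d) (L : E d → E m → ℝ) (σ K1 K2 α : ℝ)
    (hstd : StdSetup F L σ K1 K2) (hsr : SRSetup F)
    (hα : ∀ x : E d, Tendsto (fun T : ℝ => Val F L T x / T) atTop (𝓝 α)) :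
    ∃ C : ℝ, 0 ≤ C ∧ ∀ φ : E d → ℝ, Continuous φ → ZPeriodic φ →
      Dominated F L α φ → ∀ x y : E d, |φ x - φ y| ≤ C * dSR F x y := by
  obtain ⟨B, hB0, hB⟩ := hstd.L_per.exists_bound hstd.L_c2.continuous
  refine ⟨B + |α|, by positivity, fun φ _ hper hdom x y => ?_⟩
  obtain ⟨γ, u, hpair, rfl, ⟨k, hk⟩, hu⟩ := hsr.geodesic x y
  have hT : 0 ≤ dSR F (γ 0) y := Real.sInf_nonneg fun _ h => h.1
  set T := dSR F (γ 0) y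
  rw [← hper y k, ← hk]
  rcases hT.eq_or_lt with hT0 | hTpos
  · simp [← hT0]
  have hforward := hdom 0 T γ u hTpos hpair
  have hbackward := hdom 0 T _ _ hTpos (hpair.reverse hT)
  rw [cost_reverse] at hbackward
  simp only [sub_self, sub_zero] at hforward hbackward
  have hc := abs_le.1 (abs_cost_le hB hT γ hu)
  have hc' := abs_le.1 (abs_cost_le hB hT γ (u := fun t => -u t) (by simpa using hu))
  have hαT : -α * T ≤ |α| * T := mul_le_mul_of_nonneg_right (neg_le_abs α) hT
  rw [abs_le]
  constructor <;> linarith [hc.2, hc'.2]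

end SubRiemannianAM
end
end

section
/- The projected Aubry set $\mathcal{A}=\{x\in\mathbb{T}^d : h(x,x)=0\}$ is a closed (hence compact) subset of $\mathbb{T}^d$. -/
/- Aubry-Mather theory for sub-Riemannian control systems
   (P. Cannarsa, C. Mendico et al., arXiv:2306.03808).

   We model the torus `𝕋^d` as `ℝ^d` modulo `ℤ^d`: points are represented by
   elements of `E d := EuclideanSpace ℝ (Fin d)`, functions on the torus are
   `ℤ^d`-periodic functions on `ℝ^d`, and equality of torus points is equality
   up to an integer translation (`torusEq`). -/

open MeasureTheory Filter Topology Set Metric Asymptotics RealInnerProductSpace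

noncomputable section

namespace SubRiemannianAM

variable {d m : ℕ}

/-- Concatenation at time `a` of two functions of time, the second one started at `0`. -/
def glue {V : Type*} (a : ℝ) (f g : ℝ → V) (s : ℝ) : V :=
  if s ≤ a then f s else g (s - a)

section Glue

variable {V : Type*} {a b : ℝ} {f g : ℝ → V}

lemma glue_of_le {s : ℝ} (h : s ≤ a) : glue a f g s = f s := if_pos h

lemma glue_of_lt {s : ℝ} (h : a < s) : glue a f g s = g (s - a) := if_neg h.not_ge

lemma glue_of_ge (hfg : f a = g 0) {s : ℝ} (h : a ≤ s) : glue a f g s = g (s - a) := by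
  rcases h.eq_or_lt with rfl | h
  · rw [glue_of_le le_rfl, sub_self, hfg]
  · exact glue_of_lt h

lemma map₂_glue {U W : Type*} (Φ : V → U → W) (u v : ℝ → U) (s : ℝ) :
    Φ (glue a f g s) (glue a u v s) =
      glue a (fun s => Φ (f s) (u s)) (fun s => Φ (g s) (v s)) s := by
  unfold glue
  split_ifs <;> rfl

lemma continuousOn_glue [TopologicalSpace V] (ha : 0 ≤ a) (hb : 0 ≤ b) (hfg : f a = g 0)
    (hf : ContinuousOn f (Icc 0 a)) (hg : ContinuousOn g (Icc 0 b)) :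
    ContinuousOn (glue a f g) (Icc 0 (a + b)) := by
  rw [← Icc_union_Icc_eq_Icc ha (le_add_of_nonneg_right hb)]
  refine ContinuousOn.union_of_isClosed ?_ ?_ isClosed_Icc isClosed_Icc
  · exact hf.congr fun s hs => glue_of_le hs.2
  · refine ContinuousOn.congr (f := fun s => g (s - a)) ?_ fun s hs => glue_of_ge hfg hs.1
    refine hg.comp (by fun_prop) fun s hs => ⟨?_, ?_⟩
    · linarith [hs.1]
    · linarith [hs.2]

variable [NormedAddCommGroup V]

lemma intervalIntegrable_glue_left (ha : 0 ≤ a) :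
    IntervalIntegrable (glue a f g) volume 0 a ↔ IntervalIntegrable f volume 0 a := by
  refine intervalIntegrable_congr fun s hs => ?_
  rw [uIoc_of_le ha] at hs
  exact glue_of_le hs.2

lemma intervalIntegrable_glue_right (hb : 0 ≤ b) :
    IntervalIntegrable (glue a f g) volume a (a + b) ↔ IntervalIntegrable g volume 0 b := by
  have h : IntervalIntegrable (glue a f g) volume a (a + b) ↔
      IntervalIntegrable (fun s => g (s - a)) volume a (a + b) := by
    refine intervalIntegrable_congr fun s hs => ?_
    rw [uIoc_of_le (le_add_of_nonneg_right hb)] at hs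
    exact glue_of_lt hs.1
  rw [h]
  constructor
  · intro h
    simpa using h.comp_add_right a
  · intro h
    simpa [add_comm] using h.comp_sub_right a

lemma intervalIntegrable_glue (ha : 0 ≤ a) (hb : 0 ≤ b) (hf : IntervalIntegrable f volume 0 a)
    (hg : IntervalIntegrable g volume 0 b) :
    IntervalIntegrable (glue a f g) volume 0 (a + b) :=
  ((intervalIntegrable_glue_left ha).2 hf).trans ((intervalIntegrable_glue_right hb).2 hg)

variable [NormedSpace ℝ V]

lemma integral_glue_left {t : ℝ} (ht : 0 ≤ t) (hta : t ≤ a) :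
    ∫ s in (0 : ℝ)..t, glue a f g s = ∫ s in (0 : ℝ)..t, f s := by
  refine intervalIntegral.integral_congr fun s hs => ?_
  rw [uIcc_of_le ht] at hs
  exact glue_of_le (hs.2.trans hta)

lemma integral_glue_right {t : ℝ} (hat : a ≤ t) :
    ∫ s in a..t, glue a f g s = ∫ s in (0 : ℝ)..(t - a), g s := by
  have h : ∫ s in a..t, glue a f g s = ∫ s in a..t, g (s - a) := by
    refine intervalIntegral.integral_congr_ae (ae_of_all _ fun s hs => ?_)
    rw [uIoc_of_le hat] at hs
    exact glue_of_lt hs.1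
  rw [h, intervalIntegral.integral_comp_sub_right, sub_self]

lemma integral_glue (ha : 0 ≤ a) (hb : 0 ≤ b) (hf : IntervalIntegrable f volume 0 a)
    (hg : IntervalIntegrable g volume 0 b) :
    ∫ s in (0 : ℝ)..(a + b), glue a f g s =
      (∫ s in (0 : ℝ)..a, f s) + ∫ s in (0 : ℝ)..b, g s := by
  rw [← intervalIntegral.integral_add_adjacent_intervals
    ((intervalIntegrable_glue_left ha).2 hf) ((intervalIntegrable_glue_right hb).2 hg),
    integral_glue_left ha le_rfl, integral_glue_right (le_add_of_nonneg_right hb),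
    add_sub_cancel_left]

end Glue

lemma not_intervalIntegrable_glue_left {a b : ℝ} {f g : ℝ → ℝ} (ha : 0 ≤ a) (hb : 0 ≤ b)
    (hf : ¬ IntervalIntegrable f volume 0 a) :
    ¬ IntervalIntegrable (glue a f g) volume 0 (a + b) := fun h => by
  refine hf ((intervalIntegrable_glue_left (g := g) ha).1 (h.mono_set ?_))
  rw [uIcc_of_le ha, uIcc_of_le (by positivity)]
  exact Icc_subset_Icc_right (by linarith)

lemma not_intervalIntegrable_glue_right {a b : ℝ} {f g : ℝ → ℝ} (ha : 0 ≤ a) (hb : 0 ≤ b)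
    (hg : ¬ IntervalIntegrable g volume 0 b) :
    ¬ IntervalIntegrable (glue a f g) volume 0 (a + b) := fun h => by
  refine hg ((intervalIntegrable_glue_right (f := f) (a := a) hb).1 (h.mono_set ?_))
  rw [uIcc_of_le (by linarith), uIcc_of_le (by positivity)]
  exact Icc_subset_Icc_left ha

lemma IsPair.glue {F : E d → E m →L[ℝ] E d} {a b : ℝ} {γ₁ γ₂ : ℝ → E d} {u₁ u₂ : ℝ → E m}
    (ha : 0 ≤ a) (hb : 0 ≤ b) (h₁ : IsPair F 0 a γ₁ u₁) (h₂ : IsPair F 0 b γ₂ u₂)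
    (h : γ₁ a = γ₂ 0) :
    IsPair F 0 (a + b) (glue a γ₁ γ₂) (glue a u₁ u₂) := by
  have hab : 0 ≤ a + b := by positivity
  have hI {f : ℝ → E d} {c : ℝ} (hc : 0 ≤ c) (hf : IntegrableOn f (Icc 0 c)) :
      IntervalIntegrable f volume 0 c := (intervalIntegrable_iff_integrableOn_Icc_of_le hc).2 hf
  have hr₁ := hI ha h₁.rhs_int
  have hr₂ := hI hb h₂.rhs_int
  refine ⟨continuousOn_glue ha hb h h₁.cont h₂.cont, ?_, ?_, ?_⟩
  · have e : (fun s => ‖SubRiemannianAM.glue a u₁ u₂ s‖ ^ 2) =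
        SubRiemannianAM.glue a (fun s => ‖u₁ s‖ ^ 2) (fun s => ‖u₂ s‖ ^ 2) := by
      funext s
      exact map₂_glue (f := u₁) (g := u₂) (fun v _ => ‖v‖ ^ 2) u₁ u₂ s
    rw [e, ← intervalIntegrable_iff_integrableOn_Icc_of_le hab]
    exact intervalIntegrable_glue ha hb
      ((intervalIntegrable_iff_integrableOn_Icc_of_le ha).2 h₁.u_sq_int)
      ((intervalIntegrable_iff_integrableOn_Icc_of_le hb).2 h₂.u_sq_int)
  · rw [← intervalIntegrable_iff_integrableOn_Icc_of_le hab]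
    simp_rw [map₂_glue (fun x v => F x v)]
    exact intervalIntegrable_glue ha hb hr₁ hr₂
  · intro t ht
    simp_rw [map₂_glue (fun x v => F x v)]
    rcases le_total t a with hta | hta
    · rw [glue_of_le hta, glue_of_le ha, integral_glue_left ht.1 hta]
      exact h₁.ode t ⟨ht.1, hta⟩
    · have htb : t - a ∈ Icc 0 b := ⟨by linarith, by linarith [ht.2]⟩
      have hg : t = a + (t - a) := by ring
      rw [glue_of_ge h hta, glue_of_le ha, h₂.ode _ htb, ← h, h₁.ode a ⟨ha, le_rfl⟩]
      conv_rhs => rw [hg]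
      rw [integral_glue ha htb.1 hr₁ (hr₂.mono_set ?_), add_assoc]
      rw [uIcc_of_le htb.1, uIcc_of_le hb]
      exact Icc_subset_Icc_right htb.2

lemma IsPair.add_intVec {F : E d → E m →L[ℝ] E d} (hF : ZPeriodic F) {a b : ℝ} {γ : ℝ → E d}
    {u : ℝ → E m} (h : IsPair F a b γ u) (k : Fin d → ℤ) :
    IsPair F a b (fun s => γ s + intVec k) u := by
  refine ⟨h.cont.add continuousOn_const, h.u_sq_int, ?_, fun t ht => ?_⟩
  · simpa only [hF _ k] using h.rhs_int
  · simp only [hF _ k]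
    rw [h.ode t ht]
    abel

lemma cost_add_intVec {L : E d → E m → ℝ} (hL : ZPeriodic2 L) (γ : ℝ → E d) (u : ℝ → E m)
    (k : Fin d → ℤ) (a b : ℝ) : cost L (fun s => γ s + intVec k) u a b = cost L γ u a b := by
  simp only [cost, hL _ k]

lemma isPair_const (F : E d → E m →L[ℝ] E d) (T : ℝ) (x : E d) :
    IsPair F 0 T (fun _ => x) (fun _ => 0) :=
  ⟨continuousOn_const, by simp, by simp, by simp⟩

lemma intVec_zero : intVec (0 : Fin d → ℤ) = 0 := by
  ext i
  simp [intVec]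

lemma intVec_add (k l : Fin d → ℤ) : intVec (k + l) = intVec k + intVec l := by
  ext i
  simp [intVec]

lemma torusEq_refl (x : E d) : torusEq x x := ⟨0, by simp [intVec_zero]⟩

lemma isCompact_unitCube : IsCompact {x : E d | ∀ i, x i ∈ Icc (0 : ℝ) 1} := by
  have h := (EuclideanSpace.equiv (Fin d) ℝ).toHomeomorph.isCompact_preimage.2
    (isCompact_univ_pi fun _ : Fin d => isCompact_Icc (a := (0 : ℝ)) (b := 1))
  convert h using 1
  ext x
  simp only [mem_ofPred_eq, mem_preimage, mem_univ_pi]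
  rfl

lemma exists_add_intVec_mem_unitCube (x : E d) :
    ∃ k : Fin d → ℤ, ∀ i, (x + intVec k) i ∈ Icc (0 : ℝ) 1 := by
  refine ⟨fun i => -⌊x i⌋, fun i => ?_⟩
  have h : (x + intVec fun i => -⌊x i⌋) i = Int.fract (x i) := by
    simp [intVec, Int.fract, sub_eq_add_neg]
  rw [h]
  exact ⟨Int.fract_nonneg _, (Int.fract_lt_one _).le⟩

/-- A continuous Lagrangian on the torus is bounded on bounded sets of controls. -/
lemma exists_bound_of_norm_le_one {L : E d → E m → ℝ}
    (hc : Continuous fun p : E d × E m => L p.1 p.2) (hL : ZPeriodic2 L) :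
    ∃ C : ℝ, 0 ≤ C ∧ ∀ x u, ‖u‖ ≤ 1 → ‖L x u‖ ≤ C := by
  obtain ⟨C, hC⟩ := (isCompact_unitCube (d := d)).prod (isCompact_closedBall (0 : E m) 1)
    |>.exists_bound_of_continuousOn hc.continuousOn
  refine ⟨max C 0, le_max_right _ _, fun x u hu => ?_⟩
  obtain ⟨k, hk⟩ := exists_add_intVec_mem_unitCube x
  rw [← hL x k u]
  exact (hC (x + intVec k, u) ⟨hk, by simpa using hu⟩).trans (le_max_left _ _)

/-- A continuous family of injective linear maps has a continuous family of left inverses. -/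
lemma exists_continuous_leftInverse {F : E d → E m →L[ℝ] E d} (hF : Continuous F)
    (hinj : ∀ x, Function.Injective (F x)) :
    ∃ G : E d → E d →L[ℝ] E m, Continuous G ∧ ∀ x v, G x (F x v) = v := by
  let A : E d → E d →L[ℝ] E m := fun x => ContinuousLinearMap.adjoint (F x)
  have hA : Continuous A := (ContinuousLinearMap.adjoint (𝕜 := ℝ)).continuous.comp hF
  let M : E d → E m →L[ℝ] E m := fun x => (A x).comp (F x)
  have hM : Continuous M := hA.clm_comp hF
  have hMinj (x : E d) : Function.Injective (M x) := by
    rw [injective_iff_map_eq_zero]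
    intro v hv
    have h : ⟪F x v, F x v⟫ = 0 := by
      rw [← ContinuousLinearMap.adjoint_inner_right]
      change ⟪v, M x v⟫ = 0
      rw [hv, inner_zero_right]
    exact (injective_iff_map_eq_zero (F x)).1 (hinj x) v (inner_self_eq_zero.1 h)
  have hMunit (x : E d) : IsUnit (M x) := by
    let e := (LinearEquiv.ofInjectiveEndo (M x : E m →ₗ[ℝ] E m) (hMinj x)).toContinuousLinearEquiv
    exact ⟨ContinuousLinearEquiv.toUnit e, by ext1 v; rfl⟩
  refine ⟨fun x => (Ring.inverse (M x)).comp (A x), ?_, fun x v => ?_⟩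
  · refine Continuous.clm_comp (continuous_iff_continuousAt.2 fun x => ?_) hA
    obtain ⟨w, hw⟩ := hMunit x
    have h := NormedRing.inverse_continuousAt w
    rw [hw] at h
    exact ContinuousAt.comp (f := M) h hM.continuousAt
  · change (Ring.inverse (M x) * M x) v = v
    rw [Ring.inverse_mul_cancel _ (hMunit x)]
    rfl

lemma IsPair.aestronglyMeasurable_control {F : E d → E m →L[ℝ] E d} (hF : Continuous F)
    (hinj : ∀ x, Function.Injective (F x)) {a b : ℝ} {γ : ℝ → E d} {u : ℝ → E m}
    (h : IsPair F a b γ u) : AEStronglyMeasurable u (volume.restrict (Icc a b)) := by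
  obtain ⟨G, hG, hGF⟩ := exists_continuous_leftInverse hF hinj
  have h₁ : AEStronglyMeasurable (fun s => G (γ s)) (volume.restrict (Icc a b)) :=
    (hG.comp_continuousOn h.cont).aestronglyMeasurable measurableSet_Icc
  have h₂ := isBoundedBilinearMap_apply.continuous.comp_aestronglyMeasurable
    (h₁.prodMk h.rhs_int.aestronglyMeasurable)
  simpa only [hGF] using h₂

/-- Along a pair with controls in the unit ball, the Lagrangian is integrable. -/
lemma IsPair.intervalIntegrable_of_norm_le_one {F : E d → E m →L[ℝ] E d} {L : E d → E m → ℝ}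
    (hF : Continuous F) (hinj : ∀ x, Function.Injective (F x))
    (hL : Continuous fun p : E d × E m => L p.1 p.2) {C : ℝ}
    (hC : ∀ x u, ‖u‖ ≤ 1 → ‖L x u‖ ≤ C) {T : ℝ} (hT : 0 ≤ T) {γ : ℝ → E d} {u : ℝ → E m}
    (h : IsPair F 0 T γ u) (hu : ∀ᵐ s ∂(volume.restrict (Icc 0 T)), ‖u s‖ ≤ 1) :
    IntervalIntegrable (fun s => L (γ s) (u s)) volume 0 T := by
  rw [intervalIntegrable_iff_integrableOn_Icc_of_le hT]
  have hm : AEStronglyMeasurable (fun s => L (γ s) (u s)) (volume.restrict (Icc 0 T)) :=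
    hL.comp_aestronglyMeasurable ((h.cont.aestronglyMeasurable measurableSet_Icc).prodMk
      (h.aestronglyMeasurable_control hF hinj))
  exact Integrable.of_bound hm C (hu.mono fun s hs => hC _ _ hs)

lemma cost_le_of_norm_le_one {L : E d → E m → ℝ} {C : ℝ}
    (hC : ∀ x u, ‖u‖ ≤ 1 → ‖L x u‖ ≤ C) {T : ℝ} (hT : 0 ≤ T) {γ : ℝ → E d} {u : ℝ → E m}
    (hu : ∀ᵐ s ∂(volume.restrict (Icc 0 T)), ‖u s‖ ≤ 1) : cost L γ u 0 T ≤ C * T := by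
  have h : ‖∫ s in (0 : ℝ)..T, L (γ s) (u s)‖ ≤ C * |T - 0| := by
    refine intervalIntegral.norm_integral_le_of_norm_le_const_ae ?_
    rw [ae_restrict_iff' measurableSet_Icc] at hu
    filter_upwards [hu] with s hs hsT
    rw [uIoc_of_le hT] at hsT
    exact hC _ _ (hs (Ioc_subset_Icc_self hsT))
  rw [sub_zero, abs_of_nonneg hT] at h
  exact (le_abs_self _).trans h

/-- The value `0` of the cost of a non-integrable concatenation is accounted for. -/
lemma cost_glue_le_left {L : E d → E m → ℝ} {a b c : ℝ} {γ₁ γ₂ : ℝ → E d} {u₁ u₂ : ℝ → E m}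
    (ha : 0 ≤ a) (hb : 0 ≤ b) (hc : 0 ≤ c)
    (h₁ : IntervalIntegrable (fun s => L (γ₁ s) (u₁ s)) volume 0 a) (h : cost L γ₁ u₁ 0 a ≤ c) :
    cost L (glue a γ₁ γ₂) (glue a u₁ u₂) 0 (a + b) ≤ cost L γ₂ u₂ 0 b + c := by
  unfold cost at *
  simp_rw [map₂_glue L]
  by_cases h₂ : IntervalIntegrable (fun s => L (γ₂ s) (u₂ s)) volume 0 b
  · rw [integral_glue ha hb h₁ h₂]
    linarith
  · rw [intervalIntegral.integral_undef h₂,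
      intervalIntegral.integral_undef (not_intervalIntegrable_glue_right ha hb h₂)]
    simpa using hc

lemma cost_glue_le_right {L : E d → E m → ℝ} {a b c : ℝ} {γ₁ γ₂ : ℝ → E d} {u₁ u₂ : ℝ → E m}
    (ha : 0 ≤ a) (hb : 0 ≤ b) (hc : 0 ≤ c)
    (h₂ : IntervalIntegrable (fun s => L (γ₂ s) (u₂ s)) volume 0 b) (h : cost L γ₂ u₂ 0 b ≤ c) :
    cost L (glue a γ₁ γ₂) (glue a u₁ u₂) 0 (a + b) ≤ cost L γ₁ u₁ 0 a + c := by
  unfold cost at *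
  simp_rw [map₂_glue L]
  by_cases h₁ : IntervalIntegrable (fun s => L (γ₁ s) (u₁ s)) volume 0 a
  · rw [integral_glue ha hb h₁ h₂]
    linarith
  · rw [intervalIntegral.integral_undef h₁,
      intervalIntegral.integral_undef (not_intervalIntegrable_glue_left ha hb h₁)]
    simpa using hc

lemma neg_mul_le_cost {L : E d → E m → ℝ} {K T : ℝ} (hK : 0 ≤ K) (hT : 0 ≤ T)
    (hL : ∀ x u, -K ≤ L x u) (γ : ℝ → E d) (u : ℝ → E m) : -(K * T) ≤ cost L γ u 0 T := by
  unfold cost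
  by_cases h : IntervalIntegrable (fun s => L (γ s) (u s)) volume 0 T
  · have := intervalIntegral.integral_mono_on hT (intervalIntegrable_const (c := -K)) h
      fun s _ => hL (γ s) (u s)
    simp only [intervalIntegral.integral_const, sub_zero, smul_eq_mul] at this
    linarith
  · rw [intervalIntegral.integral_undef h]
    exact neg_nonpos.2 (by positivity)

lemma dSR_nonneg (F : E d → E m →L[ℝ] E d) (x y : E d) : 0 ≤ dSR F x y :=
  Real.sInf_nonneg fun _ hT => hT.1

lemma dSR_self (F : E d → E m →L[ℝ] E d) (x : E d) : dSR F x x = 0 := by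
  refine le_antisymm (csInf_le ⟨0, fun T hT => hT.1⟩ ?_) (dSR_nonneg F x x)
  exact ⟨le_rfl, _, _, isPair_const F 0 x, rfl, torusEq_refl x, by simp⟩

/-- Loops at `y` give loops at `x`, by following geodesics from `x` to `y` and back. -/
lemma exists_action_add_le {F : E d → E m →L[ℝ] E d} {L : E d → E m → ℝ} {σ K1 K2 : ℝ}
    (hstd : StdSetup F L σ K1 K2) (hsr : SRSetup F) :
    ∃ C : ℝ, 0 ≤ C ∧ ∀ (x y : E d) (t : ℝ), 0 ≤ t →
      Action F L (t + (dSR F x y + dSR F y x)) x x ≤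
        Action F L t y y + C * (dSR F x y + dSR F y x) := by
  have hLc := hstd.L_c2.continuous
  obtain ⟨C, hC0, hC⟩ := exists_bound_of_norm_le_one hLc hstd.L_per
  refine ⟨C, hC0, fun x y t ht => ?_⟩
  have hxy := dSR_nonneg F x y
  have hyx := dSR_nonneg F y x
  rw [← sub_le_iff_le_add]
  refine le_csInf ⟨_, _, _, isPair_const F t y, rfl, torusEq_refl y, rfl⟩ ?_
  rintro c ⟨γ, u, hγ, hγ0, ⟨k, hk⟩, rfl⟩
  rw [sub_le_iff_le_add]
  obtain ⟨γ₁, u₁, h₁, h₁0, ⟨k₁, hk₁⟩, hu₁⟩ := hsr.geodesic x y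
  obtain ⟨γ₂, u₂, h₂, h₂0, ⟨k₂, hk₂⟩, hu₂⟩ := hsr.geodesic y x
  have i₁ := h₁.intervalIntegrable_of_norm_le_one hstd.F_c1.continuous hstd.F_rank hLc hC hxy hu₁
  have i₂ := (h₂.add_intVec hstd.F_per (k + k₁)).intervalIntegrable_of_norm_le_one
    hstd.F_c1.continuous hstd.F_rank hLc hC hyx hu₂
  have p := h₁.glue hxy ht (hγ.add_intVec hstd.F_per k₁) (by rw [hk₁, hγ0])
  have hend : glue (dSR F x y) γ₁ (fun s => γ s + intVec k₁) (dSR F x y + t) =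
      y + intVec (k + k₁) := by
    rw [glue_of_ge (by rw [hk₁, hγ0]) (le_add_of_nonneg_right ht), add_sub_cancel_left, hk,
      intVec_add, add_assoc]
  have q := p.glue (add_nonneg hxy ht) hyx (h₂.add_intVec hstd.F_per (k + k₁))
    (by rw [hend, h₂0])
  have c₁ := cost_glue_le_left (γ₂ := fun s => γ s + intVec k₁) (u₂ := u) hxy ht
    (mul_nonneg hC0 hxy) i₁ (cost_le_of_norm_le_one hC hxy hu₁)
  have c₂ := cost_glue_le_right (γ₁ := glue (dSR F x y) γ₁ (fun s => γ s + intVec k₁))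
    (u₁ := glue (dSR F x y) u₁ u) (add_nonneg hxy ht) hyx (mul_nonneg hC0 hyx) i₂
    (cost_le_of_norm_le_one hC hyx hu₂)
  rw [cost_add_intVec hstd.L_per] at c₁
  have hT : t + (dSR F x y + dSR F y x) = dSR F x y + t + dSR F y x := by ring
  have hlow (z : E d) (v : E m) : -K2 ≤ L z v := by
    have := hstd.L_coer z v
    have := mul_nonneg hstd.K1_pos.le (Real.rpow_nonneg (norm_nonneg v) σ)
    linarith
  rw [hT]
  refine le_trans (csInf_le ?_ ⟨_, _, q, ?_, ?_, rfl⟩) ?_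
  · refine ⟨-(K2 * (dSR F x y + t + dSR F y x)), ?_⟩
    rintro _ ⟨γ', u', -, -, -, rfl⟩
    exact neg_mul_le_cost hstd.K2_pos.le (by positivity) hlow γ' u'
  · rw [glue_of_le (add_nonneg hxy ht), glue_of_le hxy, h₁0]
  · refine ⟨k₂ + (k + k₁), ?_⟩
    rw [glue_of_ge (by rw [hend, h₂0]) (le_add_of_nonneg_right hyx), add_sub_cancel_left, hk₂,
      intVec_add k₂, add_assoc]
  · linarith

/-- Real suprema are stable under small shifts, also for empty and unbounded sets. -/
lemma sSup_le_sSup_add_of_shift {S S' : Set ℝ} {c : ℝ} (hc : 0 ≤ c)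
    (h : ∀ a ∈ S, a - c ∈ S') (h' : ∀ a ∈ S', a - c ∈ S) : sSup S ≤ sSup S' + c := by
  rcases S.eq_empty_or_nonempty with rfl | hne
  · have : S' = ∅ := eq_empty_of_forall_notMem fun a ha => h' a ha
    simpa [this] using hc
  by_cases hb : BddAbove S'
  · refine csSup_le hne fun a ha => ?_
    have := le_csSup hb (h a ha)
    linarith
  · have hb' : ¬ BddAbove S := fun ⟨M, hM⟩ => hb ⟨M + c, fun a ha => by
      have := hM (h' a ha)
      linarith⟩
    rw [Real.sSup_of_not_bddAbove hb, Real.sSup_of_not_bddAbove hb']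
    simpa using hc

lemma liminf_le_liminf_add_of_shift {f g : ℝ → ℝ} {s c : ℝ} (hc : 0 ≤ c)
    (hfg : ∀ t, 0 ≤ t → f (t + s) ≤ g t + c) (hgf : ∀ t, 0 ≤ t → g (t + s) ≤ f t + c) :
    liminf f atTop ≤ liminf g atTop + c := by
  have key {f g : ℝ → ℝ} (h : ∀ t, 0 ≤ t → f (t + s) ≤ g t + c) (a : ℝ)
      (ha : ∀ᶠ t in atTop, a ≤ f t) : ∀ᶠ t in atTop, a - c ≤ g t := by
    filter_upwards [(tendsto_atTop_add_const_right atTop s tendsto_id).eventually ha,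
      eventually_ge_atTop 0] with t h₁ h₂
    have := h t h₂
    simp only [id] at h₁
    linarith
  rw [liminf_eq, liminf_eq]
  exact sSup_le_sSup_add_of_shift hc (key hfg) (key hgf)

lemma continuous_PB_diag {F : E d → E m →L[ℝ] E d} {L : E d → E m → ℝ} {σ K1 K2 : ℝ} (α : ℝ)
    (hstd : StdSetup F L σ K1 K2) (hsr : SRSetup F) :
    Continuous fun x : E d => PB F L α x x := by
  obtain ⟨C, hC0, hC⟩ := exists_action_add_le hstd hsr
  have hshift (x y : E d) (t : ℝ) (ht : 0 ≤ t) :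
      Action F L (t + (dSR F x y + dSR F y x)) x x - α * (t + (dSR F x y + dSR F y x)) ≤
        Action F L t y y - α * t + (C + |α|) * (dSR F x y + dSR F y x) := by
    have h₁ := hC x y t ht
    have h₂ := mul_le_mul_of_nonneg_right (neg_le_abs α)
      (add_nonneg (dSR_nonneg F x y) (dSR_nonneg F y x))
    linarith
  have hle (x y : E d) :
      PB F L α x x ≤ PB F L α y y + (C + |α|) * (dSR F x y + dSR F y x) := by
    refine liminf_le_liminf_add_of_shift (s := dSR F x y + dSR F y x) ?_ (hshift x y) ?_
    · have := dSR_nonneg F x y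
      have := dSR_nonneg F y x
      positivity
    · simpa only [add_comm (dSR F y x)] using hshift y x
  refine continuous_iff_continuousAt.2 fun x => ?_
  have hlim : Tendsto (fun y => (C + |α|) * (dSR F x y + dSR F y x)) (𝓝 x) (𝓝 0) := by
    have hc : Continuous fun y => (C + |α|) * (dSR F x y + dSR F y x) :=
      continuous_const.mul ((hsr.dist_cont.comp (by fun_prop : Continuous fun y => (x, y))).add
        (hsr.dist_cont.comp (by fun_prop : Continuous fun y => (y, x))))
    simpa [dSR_self] using hc.tendsto x
  refine tendsto_iff_dist_tendsto_zero.2 (squeeze_zero (fun _ => dist_nonneg) (fun y => ?_) hlim)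
  rw [Real.dist_eq, abs_sub_le_iff]
  constructor
  · have := hle y x
    rw [add_comm (dSR F y x)] at this
    linarith
  · linarith [hle x y]

/-- The projected Aubry set is closed; being a set on the
torus, it is compact (its trace on the fundamental domain is compact). -/
theorem aubry_closed {d m : ℕ}
    (F : E d → E m →L[ℝ] E d) (L : E d → E m → ℝ) (σ K1 K2 α : ℝ)
    (hstd : StdSetup F L σ K1 K2) (hsr : SRSetup F)
    (hα : ∀ x : E d, Tendsto (fun T : ℝ => Val F L T x / T) atTop (𝓝 α)) :
    IsClosed {x : E d | PB F L α x x = 0} ∧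
    IsCompact ({x : E d | PB F L α x x = 0} ∩ {x : E d | ∀ i, x i ∈ Icc (0:ℝ) 1}) := by
  have hcl : IsClosed {x : E d | PB F L α x x = 0} :=
    isClosed_eq (continuous_PB_diag α hstd hsr) continuous_const
  exact ⟨hcl, isCompact_unitCube.inter_left hcl⟩

end SubRiemannianAM
end
end
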